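/- Let φ: ℝ³ → ℂ² be smooth with compact support and m ≥ 0. Then √(1+m²) ∫_{ℝ³} |φ|² dx ≤ ∫_{ℝ³} |x| |(σ·∇)φ|² dx + (1+m²) ∫_{ℝ³} |x| |φ|² dx - ∫_{ℝ³} |φ|²/|x| dx. -/

import Mathlib

noncomputable section
open MeasureTheory Matrix Finset

abbrev E3 := EuclideanSpace ℝ (Fin 3)

/-- The Pauli matrices. -/
def pauli : Fin 3 → Matrix (Fin 2) (Fin 2) ℂ :=
  ![!![0, 1; 1, 0], !![0, -Complex.I; Complex.I, 0], !![1, 0; 0, -1]]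

/-- `σ · a` for a real vector `a`. -/
def sigmaDot (a : Fin 3 → ℝ) : Matrix (Fin 2) (Fin 2) ℂ :=
  ∑ k, (a k : ℂ) • pauli k

/-- `(σ · ∇)φ` for a `ℂ²`-valued function. -/
def sigmaGrad (φ : E3 → Fin 2 → ℂ) (x : E3) : Fin 2 → ℂ :=
  ∑ k, (pauli k).mulVec (fderiv ℝ φ x (EuclideanSpace.single k 1))

/-- The radial derivative `∂_r φ(x) = (x/|x|)·∇φ(x)`. -/
def radialDeriv {F : Type*} [NormedAddCommGroup F] [NormedSpace ℝ F]
    (φ : E3 → F) (x : E3) : F := fderiv ℝ φ x (‖x‖⁻¹ • x)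

/-- The Dirac matrices `α_k` in block form. -/
def diracAlpha (k : Fin 3) : Matrix (Fin 4) (Fin 4) ℂ :=
  Matrix.reindex finSumFinEquiv finSumFinEquiv ((Matrix.fromBlocks 0 (pauli k) (pauli k) 0 : Matrix (Fin 2 ⊕ Fin 2) (Fin 2 ⊕ Fin 2) ℂ))

/-- The Dirac matrix `β` in block form. -/
def diracBeta : Matrix (Fin 4) (Fin 4) ℂ :=
  Matrix.reindex finSumFinEquiv finSumFinEquiv ((Matrix.fromBlocks 1 0 0 (-1) : Matrix (Fin 2 ⊕ Fin 2) (Fin 2 ⊕ Fin 2) ℂ))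

/-- `(α · ∇)ψ` for a `ℂ⁴`-valued function. -/
def alphaGrad (ψ : E3 → Fin 4 → ℂ) (x : E3) : Fin 4 → ℂ :=
  ∑ k, (diracAlpha k).mulVec (fderiv ℝ ψ x (EuclideanSpace.single k 1))

/-- The `k`-th partial derivative of a scalar function. -/
def partialDeriv (k : Fin 3) (f : E3 → ℝ) (x : E3) : ℝ :=
  fderiv ℝ f x (EuclideanSpace.single k 1)

lemma continuous_partialDeriv {f : E3 → ℝ} (hf : ContDiff ℝ 1 f) (k : Fin 3) :
    Continuous (partialDeriv k f) :=
  (hf.continuous_fderiv one_ne_zero).clm_apply continuous_const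

lemma contDiff_partialDeriv {f : E3 → ℝ} (hf : ContDiff ℝ 2 f) (k : Fin 3) :
    ContDiff ℝ 1 (partialDeriv k f) :=
  (hf.fderiv_right (m := 1) (by norm_num)).clm_apply contDiff_const

lemma hasCompactSupport_partialDeriv {f : E3 → ℝ} (hf : HasCompactSupport f) (k : Fin 3) :
    HasCompactSupport (partialDeriv k f) :=
  hf.fderiv_apply ℝ _

lemma partialDeriv_comm {f : E3 → ℝ} (hf : ContDiff ℝ 2 f) (i j : Fin 3) (x : E3) :
    partialDeriv i (partialDeriv j f) x = partialDeriv j (partialDeriv i f) x := by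
  have h1 : DifferentiableAt ℝ (fderiv ℝ f) x :=
    ((hf.fderiv_right (m := 1) (by norm_num)).differentiable one_ne_zero) x
  have h (i j : Fin 3) : partialDeriv i (partialDeriv j f) x =
      fderiv ℝ (fderiv ℝ f) x (EuclideanSpace.single i 1) (EuclideanSpace.single j 1) := by
    unfold partialDeriv
    rw [fderiv_clm_apply h1 (differentiableAt_const _)]
    simp
  rw [h, h]
  exact (hf.contDiffAt.isSymmSndFDerivAt (by simp)) _ _

lemma partialDeriv_mul {f g : E3 → ℝ} (hf : ContDiff ℝ 1 f) (hg : ContDiff ℝ 1 g) (k : Fin 3)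
    (x : E3) : partialDeriv k (fun y => f y * g y) x =
      partialDeriv k f x * g x + f x * partialDeriv k g x := by
  unfold partialDeriv
  rw [fderiv_fun_mul (hf.differentiable one_ne_zero x) (hg.differentiable one_ne_zero x)]
  simp
  ring

lemma partialDeriv_add {f g : E3 → ℝ} (hf : ContDiff ℝ 1 f) (hg : ContDiff ℝ 1 g) (k : Fin 3)
    (x : E3) : partialDeriv k (fun y => f y + g y) x =
      partialDeriv k f x + partialDeriv k g x := by
  unfold partialDeriv
  rw [fderiv_fun_add (hf.differentiable one_ne_zero x) (hg.differentiable one_ne_zero x)]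
  simp

lemma partialDeriv_sub {f g : E3 → ℝ} (hf : ContDiff ℝ 1 f) (hg : ContDiff ℝ 1 g) (k : Fin 3)
    (x : E3) : partialDeriv k (fun y => f y - g y) x =
      partialDeriv k f x - partialDeriv k g x := by
  unfold partialDeriv
  rw [fderiv_fun_sub (hf.differentiable one_ne_zero x) (hg.differentiable one_ne_zero x)]
  simp

lemma contDiff_coord {n : WithTop ℕ∞} (k : Fin 3) : ContDiff ℝ n (fun x : E3 => x k) :=
  (EuclideanSpace.proj (𝕜 := ℝ) k).contDiff

lemma partialDeriv_coord (k l : Fin 3) (x : E3) :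
    partialDeriv k (fun y => y l) x = if l = k then 1 else 0 := by
  unfold partialDeriv
  have : HasFDerivAt (fun y : E3 => y l) (EuclideanSpace.proj (𝕜 := ℝ) l) x :=
    (EuclideanSpace.proj (𝕜 := ℝ) l).hasFDerivAt
  rw [this.fderiv]
  simp

lemma integrable_of_contDiff {f : E3 → ℝ} (hf : ContDiff ℝ 1 f) (hc : HasCompactSupport f) :
    Integrable f :=
  hf.continuous.integrable_of_hasCompactSupport hc

lemma integrable_partialDeriv {f : E3 → ℝ} (hf : ContDiff ℝ 1 f) (hc : HasCompactSupport f)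
    (k : Fin 3) : Integrable (partialDeriv k f) :=
  (continuous_partialDeriv hf k).integrable_of_hasCompactSupport
    (hasCompactSupport_partialDeriv hc k)

/-- The singularity `1 / ‖x‖` is locally integrable on `ℝ³`. -/
lemma integrable_div_norm {f : E3 → ℝ} (hf : Continuous f) (hc : HasCompactSupport f) :
    Integrable (fun x => f x / ‖x‖) := by
  have hloc : LocallyIntegrable (fun x : E3 => ‖x‖⁻¹) := by
    refine locallyIntegrable_of_norm_le_rpow (C := 1) (α := 1) (by simp) (by simp) ?_
      (by fun_prop)
    filter_upwards with x
    simp [Real.rpow_neg_one]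
  have := hloc.integrable_smul_left_of_hasCompactSupport hf hc
  simpa [div_eq_mul_inv] using this

lemma integral_partialDeriv {f : E3 → ℝ} (hf : ContDiff ℝ 1 f) (hc : HasCompactSupport f)
    (k : Fin 3) : ∫ x, partialDeriv k f x = 0 := by
  have := integral_mul_fderiv_eq_neg_fderiv_mul_of_integrable (μ := (volume : Measure E3))
    (f := fun _ : E3 => (1 : ℝ)) (g := f) (v := EuclideanSpace.single k 1)
    (by simp) (by simpa using! integrable_partialDeriv hf hc k)
    (by simpa using integrable_of_contDiff hf hc) (by simp)
    (fun x _ => hf.differentiable one_ne_zero x)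
  simpa [partialDeriv] using this

/-- Integration by parts against the Lipschitz weight `‖x‖`. -/
lemma integral_coord_div_norm_mul {f : E3 → ℝ} (hf : ContDiff ℝ 1 f) (hc : HasCompactSupport f)
    (k : Fin 3) : ∫ x : E3, x k * f x / ‖x‖ = -∫ x : E3, ‖x‖ * partialDeriv k f x := by
  obtain ⟨C, hC⟩ := hf.lipschitzWith_of_hasCompactSupport hc one_ne_zero
  have h := LipschitzWith.integral_lineDeriv_mul_eq (μ := (volume : Measure E3)) (lipschitzWith_one_norm (E := E3))
    hC hc (EuclideanSpace.single k 1)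
  rw [← integral_neg]
  have h1 : ∫ x : E3, x k * f x / ‖x‖ =
      ∫ x : E3, lineDeriv ℝ (norm : E3 → ℝ) x (EuclideanSpace.single k 1) * f x := by
    apply integral_congr_ae
    filter_upwards [Measure.ae_ne (volume : Measure E3) 0] with x hx
    have hd : HasFDerivAt (fun y : E3 => Real.sqrt (‖y‖ ^ 2)) _ x :=
      ((hasStrictFDerivAt_norm_sq x).hasFDerivAt).sqrt (by positivity)
    simp only [Real.sqrt_sq (norm_nonneg _)] at hd
    have hd' : HasFDerivAt (norm : E3 → ℝ) _ x := hd
    rw [hd'.differentiableAt.lineDeriv_eq_fderiv, hd'.fderiv]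
    have : ‖x‖ ≠ 0 := by positivity
    simp [EuclideanSpace.inner_single_right]
    field_simp
  rw [h1, h]
  congr 1 with x
  rw [(hf.differentiable one_ne_zero x).lineDeriv_eq_fderiv, map_neg]
  simp [partialDeriv]
  ring

/-- The vector field `‖x‖ xₗ w` has vanishing total flux when `w` is divergence free. -/
lemma integral_divergenceFree {w : Fin 3 → E3 → ℝ} (hw : ∀ k, ContDiff ℝ 1 (w k))
    (hc : ∀ k, HasCompactSupport (w k)) (hdiv : ∀ x, ∑ k, partialDeriv k (w k) x = 0)
    (l : Fin 3) :
    Integrable (fun x : E3 => ‖x‖ * w l x + x l * (∑ k, x k * w k x) / ‖x‖) ∧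
      ∫ x : E3, (‖x‖ * w l x + x l * (∑ k, x k * w k x) / ‖x‖) = 0 := by
  have hG (k) : ContDiff ℝ 1 (fun x : E3 => x l * w k x) := (contDiff_coord l).mul (hw k)
  have hGc (k) : HasCompactSupport (fun x : E3 => x l * w k x) := (hc k).mul_left
  have hI1 : Integrable (fun x : E3 => ‖x‖ * w l x) :=
    (continuous_norm.mul (hw l).continuous).integrable_of_hasCompactSupport (hc l).mul_left
  have hIk (k) : Integrable (fun x : E3 => x k * (x l * w k x) / ‖x‖) :=
    integrable_div_norm ((contDiff_coord (n := 1) k).continuous.mul (hG k).continuous)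
      (hGc k).mul_left
  have heq : (fun x : E3 => x l * (∑ k, x k * w k x) / ‖x‖) =
      fun x => ∑ k, x k * (x l * w k x) / ‖x‖ := by
    ext x
    rw [Finset.mul_sum, Finset.sum_div]
    exact Finset.sum_congr rfl fun k _ => by ring
  have hI2 : Integrable (fun x : E3 => x l * (∑ k, x k * w k x) / ‖x‖) := by
    rw [heq]
    exact integrable_finsetSum _ fun k _ => hIk k
  refine ⟨hI1.add hI2, ?_⟩
  rw [integral_add hI1 hI2, heq, integral_finsetSum _ fun k _ => hIk k]
  simp_rw [integral_coord_div_norm_mul (hG _) (hGc _)]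
  have hI3 (k) : Integrable (fun x : E3 => ‖x‖ * partialDeriv k (fun y => y l * w k y) x) :=
    (continuous_norm.mul (continuous_partialDeriv (hG k) k)).integrable_of_hasCompactSupport
      (hasCompactSupport_partialDeriv (hGc k) k).mul_left
  rw [Finset.sum_neg_distrib, ← integral_finsetSum _ fun k _ => hI3 k, ← sub_eq_add_neg,
    sub_eq_zero]
  congr 1 with x
  simp_rw [partialDeriv_mul (contDiff_coord l) (hw _), partialDeriv_coord, ← Finset.mul_sum,
    Finset.sum_add_distrib, ← Finset.mul_sum, hdiv]
  simp

/-- The components of `∇f × ∇g`. -/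
def gradCross (f g : E3 → ℝ) (k : Fin 3) (x : E3) : ℝ :=
  partialDeriv (k + 1) f x * partialDeriv (k + 2) g x -
    partialDeriv (k + 2) f x * partialDeriv (k + 1) g x

lemma contDiff_gradCross {f g : E3 → ℝ} (hf : ContDiff ℝ 2 f) (hg : ContDiff ℝ 2 g) (k : Fin 3) :
    ContDiff ℝ 1 (gradCross f g k) :=
  ((contDiff_partialDeriv hf _).mul (contDiff_partialDeriv hg _)).sub
    ((contDiff_partialDeriv hf _).mul (contDiff_partialDeriv hg _))

lemma hasCompactSupport_gradCross {f g : E3 → ℝ} (hf : HasCompactSupport f) (k : Fin 3) :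
    HasCompactSupport (gradCross f g k) :=
  (hasCompactSupport_partialDeriv hf _).mul_right.sub
    (hasCompactSupport_partialDeriv hf _).mul_right

lemma div_gradCross {f g : E3 → ℝ} (hf : ContDiff ℝ 2 f) (hg : ContDiff ℝ 2 g) (x : E3) :
    ∑ k, partialDeriv k (gradCross f g k) x = 0 := by
  have h (k) : partialDeriv k (gradCross f g k) x =
      (partialDeriv k (partialDeriv (k + 1) f) x * partialDeriv (k + 2) g x +
        partialDeriv (k + 1) f x * partialDeriv k (partialDeriv (k + 2) g) x) -
      (partialDeriv k (partialDeriv (k + 2) f) x * partialDeriv (k + 1) g x +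
        partialDeriv (k + 2) f x * partialDeriv k (partialDeriv (k + 1) g) x) := by
    unfold gradCross
    have a := contDiff_partialDeriv hf
    have b := contDiff_partialDeriv hg
    rw [partialDeriv_sub ((a _).mul (b _)) ((a _).mul (b _)), partialDeriv_mul (a _) (b _),
      partialDeriv_mul (a _) (b _)]
  simp_rw [h, Fin.sum_univ_three]
  have e1 : (1 : Fin 3) + 2 = 0 := rfl
  have e2 : (1 : Fin 3) + 1 = 2 := rfl
  have e3 : (2 : Fin 3) + 2 = 1 := rfl
  have e4 : (2 : Fin 3) + 1 = 0 := rfl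
  simp only [e1, e2, e3, e4, zero_add]
  rw [partialDeriv_comm hf 1 0, partialDeriv_comm hf 2 0, partialDeriv_comm hf 2 1,
    partialDeriv_comm hg 1 0, partialDeriv_comm hg 2 0, partialDeriv_comm hg 2 1]
  ring

/-- The divergence of `‖x‖ xₗ ∇f × ∇g`. -/
def crossFlux (f g : E3 → ℝ) (l : Fin 3) (x : E3) : ℝ :=
  ‖x‖ * gradCross f g l x + x l * (∑ k, x k * gradCross f g k x) / ‖x‖

lemma integral_crossFlux {f g : E3 → ℝ} (hf : ContDiff ℝ 2 f) (hg : ContDiff ℝ 2 g)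
    (hc : HasCompactSupport f) (l : Fin 3) :
    Integrable (crossFlux f g l) ∧ ∫ x, crossFlux f g l x = 0 :=
  integral_divergenceFree (contDiff_gradCross hf hg) (hasCompactSupport_gradCross hc)
    (div_gradCross hf hg) l

/-- The vector field `x f` has vanishing total flux. -/
lemma integral_div_coord_mul {f : E3 → ℝ} (hf : ContDiff ℝ 1 f) (hc : HasCompactSupport f) :
    Integrable (fun x : E3 => 3 * f x + ∑ k, x k * partialDeriv k f x) ∧
      ∫ x : E3, (3 * f x + ∑ k, x k * partialDeriv k f x) = 0 := by
  have hG (k) : ContDiff ℝ 1 (fun x : E3 => x k * f x) := (contDiff_coord k).mul hf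
  have hGc (k) : HasCompactSupport (fun x : E3 => x k * f x) := hc.mul_left
  have heq : (fun x : E3 => 3 * f x + ∑ k, x k * partialDeriv k f x) =
      fun x => ∑ k, partialDeriv k (fun y => y k * f y) x := by
    ext x
    simp_rw [partialDeriv_mul (contDiff_coord _) hf, partialDeriv_coord, Finset.sum_add_distrib]
    simp
  rw [heq]
  refine ⟨integrable_finsetSum _ fun k _ => integrable_partialDeriv (hG k) (hGc k) k, ?_⟩
  rw [integral_finsetSum _ fun k _ => integrable_partialDeriv (hG k) (hGc k) k]
  simp [integral_partialDeriv (hG _) (hGc _)]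

/-- The vector field `x f / √(‖x‖² + ε)` has vanishing total flux. -/
lemma integral_div_coord_mul_inv_sqrt {f : E3 → ℝ} (hf : ContDiff ℝ 1 f)
    (hc : HasCompactSupport f) {ε : ℝ} (hε : 0 < ε) :
    ∫ x : E3, ((3 * f x + ∑ k, x k * partialDeriv k f x) / Real.sqrt (‖x‖ ^ 2 + ε) -
      ‖x‖ ^ 2 * f x / Real.sqrt (‖x‖ ^ 2 + ε) ^ 3) = 0 := by
  have hpos (x : E3) : 0 < ‖x‖ ^ 2 + ε := by positivity
  have hN : ContDiff ℝ 1 (fun x : E3 => (Real.sqrt (‖x‖ ^ 2 + ε))⁻¹) :=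
    (((contDiff_norm_sq ℝ).add contDiff_const).sqrt fun x => (hpos x).ne').inv
      fun x => (Real.sqrt_pos.2 (hpos x)).ne'
  have hg : ContDiff ℝ 1 (fun x => f x * (Real.sqrt (‖x‖ ^ 2 + ε))⁻¹) := hf.mul hN
  rw [← (integral_div_coord_mul hg hc.mul_right).2]
  congr 1 with x
  have hd (k) : partialDeriv k (fun x : E3 => (Real.sqrt (‖x‖ ^ 2 + ε))⁻¹) x =
      -(x k / Real.sqrt (‖x‖ ^ 2 + ε) ^ 3) := by
    have h1 : HasFDerivAt (fun y : E3 => Real.sqrt (‖y‖ ^ 2 + ε)) _ x :=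
      (((hasStrictFDerivAt_norm_sq x).hasFDerivAt).add_const ε).sqrt (hpos x).ne'
    have h2 := (hasDerivAt_inv (Real.sqrt_pos.2 (hpos x)).ne').comp_hasFDerivAt x h1
    unfold partialDeriv
    have h3 : fderiv ℝ (fun x : E3 => (Real.sqrt (‖x‖ ^ 2 + ε))⁻¹) x = _ := h2.fderiv
    rw [h3]
    have := (Real.sqrt_pos.2 (hpos x)).ne'
    simp [EuclideanSpace.inner_single_right]
    field_simp
  simp_rw [partialDeriv_mul hf hN, hd, EuclideanSpace.norm_sq_eq, Fin.sum_univ_three,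
    Real.norm_eq_abs, sq_abs]
  ring

/-- The vector field `x f / ‖x‖` has vanishing total flux. -/
lemma integral_div_coord_mul_inv_norm {f : E3 → ℝ} (hf : ContDiff ℝ 1 f)
    (hc : HasCompactSupport f) :
    Integrable (fun x : E3 => (2 * f x + ∑ k, x k * partialDeriv k f x) / ‖x‖) ∧
      ∫ x : E3, (2 * f x + ∑ k, x k * partialDeriv k f x) / ‖x‖ = 0 := by
  have hrc : Continuous (fun x : E3 => ∑ k, x k * partialDeriv k f x) :=
    continuous_finsetSum _ fun k _ =>
      (contDiff_coord (n := 1) k).continuous.mul (continuous_partialDeriv hf k)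
  have hrs : HasCompactSupport (fun x : E3 => ∑ k, x k * partialDeriv k f x) := by
    simp_rw [Fin.sum_univ_three]
    have h (k) : HasCompactSupport (fun x : E3 => x k * partialDeriv k f x) :=
      (hasCompactSupport_partialDeriv hc k).mul_left
    exact ((h 0).add (h 1)).add (h 2)
  set ρ := fun x : E3 => ∑ k, x k * partialDeriv k f x with hρ
  simp_rw [← congrFun hρ]
  clear_value ρ
  have hfc := hf.continuous
  refine ⟨integrable_div_norm (by fun_prop) (hc.mul_left.add hrs), ?_⟩
  have hlim : Filter.Tendsto (fun ε : ℝ => ∫ x : E3,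
      ((3 * f x + ρ x) / Real.sqrt (‖x‖ ^ 2 + ε) -
        ‖x‖ ^ 2 * f x / Real.sqrt (‖x‖ ^ 2 + ε) ^ 3)) (nhdsWithin 0 (Set.Ioi 0))
      (nhds (∫ x : E3, (2 * f x + ρ x) / ‖x‖)) := by
    refine tendsto_integral_filter_of_dominated_convergence
      (fun x => (‖3 * f x + ρ x‖ + ‖f x‖) / ‖x‖) ?_ ?_ ?_ ?_
    · filter_upwards [self_mem_nhdsWithin] with ε (hε : 0 < ε)
      have h (x : E3) : Real.sqrt (‖x‖ ^ 2 + ε) ≠ 0 := by positivity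
      refine Continuous.aestronglyMeasurable ?_
      fun_prop (disch := simp [h])
    · filter_upwards [self_mem_nhdsWithin] with ε (hε : 0 < ε)
      filter_upwards [Measure.ae_ne (volume : Measure E3) 0] with x hx
      have hx' : 0 < ‖x‖ := by positivity
      have hle : ‖x‖ ≤ Real.sqrt (‖x‖ ^ 2 + ε) := Real.le_sqrt_of_sq_le (by linarith)
      have hN : 0 < Real.sqrt (‖x‖ ^ 2 + ε) := by positivity
      generalize Real.sqrt (‖x‖ ^ 2 + ε) = N at hle hN
      refine (norm_sub_le _ _).trans ?_
      rw [add_div (‖3 * f x + ρ x‖), norm_div, norm_div, norm_mul, norm_pow, norm_pow, norm_norm,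
        Real.norm_of_nonneg hN.le]
      refine add_le_add (by gcongr) ?_
      rw [div_le_div_iff₀ (by positivity) hx']
      have : ‖x‖ ^ 3 ≤ N ^ 3 := by gcongr
      nlinarith [norm_nonneg (f x), mul_le_mul_of_nonneg_left this (norm_nonneg (f x))]
    · exact integrable_div_norm (by fun_prop)
        (((hc.mul_left.add hrs).norm).add hc.norm)
    · filter_upwards [Measure.ae_ne (volume : Measure E3) 0] with x hx
      have hx' : 0 < ‖x‖ := by positivity
      have hs : Real.sqrt (‖x‖ ^ 2 + 0) = ‖x‖ := by simp
      have hcont : ContinuousAt (fun ε : ℝ => (3 * f x + ρ x) / Real.sqrt (‖x‖ ^ 2 + ε) -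
          ‖x‖ ^ 2 * f x / Real.sqrt (‖x‖ ^ 2 + ε) ^ 3) 0 := by
        have : Real.sqrt (‖x‖ ^ 2 + 0) ≠ 0 := by rw [hs]; exact hx'.ne'
        fun_prop (disch := simpa using this)
      have := hcont.tendsto.mono_left (nhdsWithin_le_nhds (s := Set.Ioi 0))
      convert this using 2
      rw [hs]
      field_simp
      ring
  refine tendsto_nhds_unique hlim (tendsto_const_nhds.congr' ?_)
  filter_upwards [self_mem_nhdsWithin] with ε hε
  rw [hρ]
  exact (integral_div_coord_mul_inv_sqrt hf hc hε).symm

/-- The twistor inequality behind `∫ |x| |∂ᵣφ|² ≤ ∫ |x| |(σ·∇)φ|²`, in terms of the partial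
derivatives of the real components of `φ = (p + iq, s + it)`. The squares in the proof are the
components of `(σ·x) L φ + i (x × L) φ` with `L = x × ∇`. -/
lemma sq_radial_le_sq_sigmaGrad {x y z r p0 p1 p2 q0 q1 q2 s0 s1 s2 t0 t1 t2 : ℝ} (hr : 0 < r)
    (hr2 : r ^ 2 = x ^ 2 + y ^ 2 + z ^ 2) :
    (x * p0 + y * p1 + z * p2) ^ 2 + (x * q0 + y * q1 + z * q2) ^ 2 +
        (x * s0 + y * s1 + z * s2) ^ 2 + (x * t0 + y * t1 + z * t2) ^ 2 ≤
      r ^ 2 * ((s0 + t1 + p2) ^ 2 + (t0 - s1 + q2) ^ 2 + (p0 - q1 - s2) ^ 2 + (q0 + p1 - t2) ^ 2)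
      - 2 * ((r ^ 2 * (-((p1 * t2 - p2 * t1) + (s1 * q2 - s2 * q1)))
          + x * (x * (-((p1 * t2 - p2 * t1) + (s1 * q2 - s2 * q1)))
            + y * (-((p2 * t0 - p0 * t2) + (s2 * q0 - s0 * q2)))
            + z * (-((p0 * t1 - p1 * t0) + (s0 * q1 - s1 * q0)))))
        + (r ^ 2 * ((p2 * s0 - p0 * s2) + (q2 * t0 - q0 * t2))
          + y * (x * ((p1 * s2 - p2 * s1) + (q1 * t2 - q2 * t1))
            + y * ((p2 * s0 - p0 * s2) + (q2 * t0 - q0 * t2))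
            + z * ((p0 * s1 - p1 * s0) + (q0 * t1 - q1 * t0))))
        + (r ^ 2 * ((s0 * t1 - s1 * t0) - (p0 * q1 - p1 * q0))
          + z * (x * ((s1 * t2 - s2 * t1) - (p1 * q2 - p2 * q1))
            + y * ((s2 * t0 - s0 * t2) - (p2 * q0 - p0 * q2))
            + z * ((s0 * t1 - s1 * t0) - (p0 * q1 - p1 * q0))))) := by
  rw [← sub_nonneg]
  have key : ∀ Y S : ℝ, r ^ 2 * Y = S / 2 → 0 ≤ S → 0 ≤ Y := fun Y S h hS =>
    nonneg_of_mul_nonneg_right (h ▸ by positivity) (by positivity : 0 < r ^ 2)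
  let L (a0 a1 a2 : ℝ) : Fin 3 → ℝ := ![y * a2 - z * a1, z * a0 - x * a2, x * a1 - y * a0]
  let M (a0 a1 a2 : ℝ) : Fin 3 → ℝ :=
    ![x * (x * a0 + y * a1 + z * a2) - r ^ 2 * a0, y * (x * a0 + y * a1 + z * a2) - r ^ 2 * a1,
      z * (x * a0 + y * a1 + z * a2) - r ^ 2 * a2]
  refine key _ (∑ k, (
    (z * L p0 p1 p2 k + x * L s0 s1 s2 k + y * L t0 t1 t2 k - M q0 q1 q2 k) ^ 2 +
    (z * L q0 q1 q2 k + x * L t0 t1 t2 k - y * L s0 s1 s2 k + M p0 p1 p2 k) ^ 2 +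
    (x * L p0 p1 p2 k - y * L q0 q1 q2 k - z * L s0 s1 s2 k - M t0 t1 t2 k) ^ 2 +
    (x * L q0 q1 q2 k + y * L p0 p1 p2 k - z * L t0 t1 t2 k + M s0 s1 s2 k) ^ 2)) ?_ 
     (by positivity)
  simp only [Fin.sum_univ_three, L, M, Matrix.cons_val]
  rw [hr2]
  ring

lemma partialDeriv_sq {f : E3 → ℝ} (hf : ContDiff ℝ 1 f) (k : Fin 3) (x : E3) :
    partialDeriv k (fun y => f y ^ 2) x = 2 * f x * partialDeriv k f x := by
  simp_rw [sq, partialDeriv_mul hf hf]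
  ring

/-- Pointwise lower bound of the integrand by divergences, for `φ = (p + iq, s + it)`. -/
lemma divergences_le {p q s t : E3 → ℝ} (hp : ContDiff ℝ 2 p) (hq : ContDiff ℝ 2 q)
    (hs : ContDiff ℝ 2 s) (ht : ContDiff ℝ 2 t) (a : ℝ) {x : E3} (hx : x ≠ 0) {u : E3 → ℝ}
    (hu : ∀ y, u y = p y ^ 2 + q y ^ 2 + s y ^ 2 + t y ^ 2) :
    2 * (crossFlux t p 0 x + crossFlux q s 0 x + (crossFlux p s 1 x + crossFlux q t 1 x) +
        (crossFlux q p 2 x + crossFlux s t 2 x)) -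
      a * (3 * u x + ∑ k, x k * partialDeriv k u x) -
        (2 * u x + ∑ k, x k * partialDeriv k u x) / ‖x‖ ≤
    ‖x‖ * ((partialDeriv 0 s x + partialDeriv 1 t x + partialDeriv 2 p x) ^ 2 +
      (partialDeriv 0 t x - partialDeriv 1 s x + partialDeriv 2 q x) ^ 2 +
      (partialDeriv 0 p x - partialDeriv 1 q x - partialDeriv 2 s x) ^ 2 +
      (partialDeriv 0 q x + partialDeriv 1 p x - partialDeriv 2 t x) ^ 2) +
      a ^ 2 * (‖x‖ * u x) - u x / ‖x‖ - a * u x := by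
  have p1 := hp.of_le one_le_two
  have q1 := hq.of_le one_le_two
  have s1 := hs.of_le one_le_two
  have t1 := ht.of_le one_le_two
  have hux (k) : partialDeriv k u x = 2 * p x * partialDeriv k p x + 2 * q x * partialDeriv k q x +
      2 * s x * partialDeriv k s x + 2 * t x * partialDeriv k t x := by
    rw [funext hu, partialDeriv_add (((p1.pow 2).add (q1.pow 2)).add (s1.pow 2)) (t1.pow 2),
      partialDeriv_add ((p1.pow 2).add (q1.pow 2)) (s1.pow 2),
      partialDeriv_add (p1.pow 2) (q1.pow 2), partialDeriv_sq p1, partialDeriv_sq q1,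
      partialDeriv_sq s1, partialDeriv_sq t1]
  have hr : 0 < ‖x‖ := by positivity
  have hr2 : ‖x‖ ^ 2 = x 0 ^ 2 + x 1 ^ 2 + x 2 ^ 2 := by
    simp [EuclideanSpace.norm_sq_eq, Fin.sum_univ_three]
  have e1 : (1 : Fin 3) + 2 = 0 := rfl
  have e2 : (1 : Fin 3) + 1 = 2 := rfl
  have e3 : (2 : Fin 3) + 2 = 1 := rfl
  have e4 : (2 : Fin 3) + 1 = 0 := rfl
  simp only [crossFlux, gradCross, Fin.sum_univ_three, hux, hu, e1, e2, e3, e4, zero_add]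
  have key := sq_radial_le_sq_sigmaGrad hr hr2 (p0 := partialDeriv 0 p x)
    (p1 := partialDeriv 1 p x) (p2 := partialDeriv 2 p x) (q0 := partialDeriv 0 q x)
    (q1 := partialDeriv 1 q x) (q2 := partialDeriv 2 q x) (s0 := partialDeriv 0 s x)
    (s1 := partialDeriv 1 s x) (s2 := partialDeriv 2 s x) (t0 := partialDeriv 0 t x)
    (t1 := partialDeriv 1 t x) (t2 := partialDeriv 2 t x)
  have sq (f : E3 → ℝ) := sq_nonneg (x 0 * partialDeriv 0 f x + x 1 * partialDeriv 1 f x +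
    x 2 * partialDeriv 2 f x + (1 + a * ‖x‖) * f x)
  have := add_le_add key (add_nonneg (add_nonneg (sq p) (sq q)) (add_nonneg (sq s) (sq t)))
  rw [← sub_nonneg] at this ⊢
  refine (div_nonneg this hr.le).trans_eq ?_
  field_simp
  ring

theorem stmt11 (φ : E3 → Fin 2 → ℂ) (hφ : ContDiff ℝ (⊤ : ℕ∞) φ) (hc : HasCompactSupport φ)
    (m : ℝ) (hm : 0 ≤ m) :
    Real.sqrt (1 + m ^ 2) * (∫ x : E3, ∑ i, ‖φ x i‖ ^ 2) ≤
      (∫ x : E3, ‖x‖ * ∑ i, ‖sigmaGrad φ x i‖ ^ 2) +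
        (1 + m ^ 2) * (∫ x : E3, ‖x‖ * ∑ i, ‖φ x i‖ ^ 2) -
          ∫ x : E3, (∑ i, ‖φ x i‖ ^ 2) / ‖x‖ := by
  have hφ2 : ContDiff ℝ 2 φ := contDiff_infty.1 hφ 2
  have hre (i) : ContDiff ℝ 2 (fun x => (φ x i).re) :=
    Complex.reCLM.contDiff.comp (contDiff_pi.1 hφ2 i)
  have him (i) : ContDiff ℝ 2 (fun x => (φ x i).im) :=
    Complex.imCLM.contDiff.comp (contDiff_pi.1 hφ2 i)
  have cre (i) : HasCompactSupport (fun x => (φ x i).re) :=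
    hc.comp_left (g := fun v : Fin 2 → ℂ => (v i).re) (by simp)
  have cim (i) : HasCompactSupport (fun x => (φ x i).im) :=
    hc.comp_left (g := fun v : Fin 2 → ℂ => (v i).im) (by simp)
  have hd (i k x) : fderiv ℝ φ x (EuclideanSpace.single k 1) i =
      ⟨partialDeriv k (fun x => (φ x i).re) x, partialDeriv k (fun x => (φ x i).im) x⟩ := by
    have h1 : HasFDerivAt (fun y => φ y i) _ x :=
      hasFDerivAt_pi'.1 ((hφ2.differentiable two_ne_zero) x).hasFDerivAt i
    have h2 : HasFDerivAt (fun y => (φ y i).re) _ x :=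
      Complex.reCLM.hasFDerivAt.comp x h1
    have h3 : HasFDerivAt (fun y => (φ y i).im) _ x :=
      Complex.imCLM.hasFDerivAt.comp x h1
    unfold partialDeriv
    rw [h2.fderiv, h3.fderiv]
    rfl
  set p := fun x => (φ x 0).re
  set q := fun x => (φ x 0).im
  set s := fun x => (φ x 1).re
  set t := fun x => (φ x 1).im
  set u := fun x => ∑ i, ‖φ x i‖ ^ 2 with hu
  have hux (x) : u x = p x ^ 2 + q x ^ 2 + s x ^ 2 + t x ^ 2 := by
    simp only [hu, Fin.sum_univ_two, Complex.sq_norm, Complex.normSq_apply, p, q, s, t]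
    ring
  have hD (x) : ∑ i, ‖sigmaGrad φ x i‖ ^ 2 =
      (partialDeriv 0 s x + partialDeriv 1 t x + partialDeriv 2 p x) ^ 2 +
      (partialDeriv 0 t x - partialDeriv 1 s x + partialDeriv 2 q x) ^ 2 +
      (partialDeriv 0 p x - partialDeriv 1 q x - partialDeriv 2 s x) ^ 2 +
      (partialDeriv 0 q x + partialDeriv 1 p x - partialDeriv 2 t x) ^ 2 := by
    simp [Complex.sq_norm, Complex.normSq_apply, sigmaGrad, pauli, Fin.sum_univ_three,
      Fin.sum_univ_two, hd, p, q, s, t]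
    ring
  have u1 : ContDiff ℝ 1 u := by
    rw [funext hux]
    exact ((((hre 0).pow 2).add ((him 0).pow 2)).add ((hre 1).pow 2)).add ((him 1).pow 2)
      |>.of_le one_le_two
  have uc : HasCompactSupport u :=
    hc.comp_left (g := fun v : Fin 2 → ℂ => ∑ i, ‖v i‖ ^ 2) (by simp)
  have Dc : Continuous (fun x => ∑ i, ‖sigmaGrad φ x i‖ ^ 2) := by
    have h (f : E3 → ℝ) (hf : ContDiff ℝ 2 f) (k) : Continuous (partialDeriv k f) :=
      continuous_partialDeriv (hf.of_le one_le_two) k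
    have hp := h p (hre 0)
    have hq := h q (him 0)
    have hs := h s (hre 1)
    have ht := h t (him 1)
    rw [funext hD]
    fun_prop
  have Ds : HasCompactSupport (fun x => ∑ i, ‖sigmaGrad φ x i‖ ^ 2) :=
    (hc.fderiv ℝ).comp_left (g := fun A : E3 →L[ℝ] (Fin 2 → ℂ) =>
      ∑ i, ‖(∑ k, (pauli k).mulVec (A (EuclideanSpace.single k 1))) i‖ ^ 2) (by simp)
  set a := Real.sqrt (1 + m ^ 2)
  have ha : 1 + m ^ 2 = a ^ 2 := (Real.sq_sqrt (by positivity)).symm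
  have ID : Integrable (fun x : E3 => ‖x‖ * ∑ i, ‖sigmaGrad φ x i‖ ^ 2) :=
    (continuous_norm.mul Dc).integrable_of_hasCompactSupport Ds.mul_left
  have Ir : Integrable (fun x : E3 => ‖x‖ * u x) :=
    (continuous_norm.mul u1.continuous).integrable_of_hasCompactSupport uc.mul_left
  have Iu := integrable_of_contDiff u1 uc
  have Iq := integrable_div_norm u1.continuous uc
  obtain ⟨I1, J1⟩ := integral_crossFlux (him 1) (hre 0) (cim 1) 0
  obtain ⟨I2, J2⟩ := integral_crossFlux (him 0) (hre 1) (cim 0) 0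
  obtain ⟨I3, J3⟩ := integral_crossFlux (hre 0) (hre 1) (cre 0) 1
  obtain ⟨I4, J4⟩ := integral_crossFlux (him 0) (him 1) (cim 0) 1
  obtain ⟨I5, J5⟩ := integral_crossFlux (him 0) (hre 0) (cim 0) 2
  obtain ⟨I6, J6⟩ := integral_crossFlux (hre 1) (him 1) (cre 1) 2
  obtain ⟨I7, J7⟩ := integral_div_coord_mul u1 uc
  obtain ⟨I8, J8⟩ := integral_div_coord_mul_inv_norm u1 uc
  have Isum := ((I1.add I2).add (I3.add I4)).add (I5.add I6)
  have h := integral_mono_ae (((Isum.const_mul 2).sub (I7.const_mul a)).sub I8)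
    (((ID.add (Ir.const_mul (a ^ 2))).sub Iq).sub (Iu.const_mul a)) (by
      filter_upwards [Measure.ae_ne (volume : Measure E3) 0] with x hx
      have := divergences_le (hre 0) (him 0) (hre 1) (him 1) a hx hux
      rw [← hD] at this
      exact this)
  rw [integral_sub' ((Isum.const_mul 2).sub (I7.const_mul a)) I8,
    integral_sub' (Isum.const_mul 2) (I7.const_mul a), integral_const_mul, integral_const_mul,
    integral_add' ((I1.add I2).add (I3.add I4)) (I5.add I6),
    integral_add' (I1.add I2) (I3.add I4), integral_add' I1 I2, integral_add' I3 I4,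
    integral_add' I5 I6, J1, J2, J3, J4, J5, J6, J7, J8,
    integral_sub' ((ID.add (Ir.const_mul (a ^ 2))).sub Iq) (Iu.const_mul a),
    integral_sub' (ID.add (Ir.const_mul (a ^ 2))) Iq, integral_add' ID (Ir.const_mul (a ^ 2)),
    integral_const_mul, integral_const_mul] at h
  rw [ha]
  linarith
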